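/- Sublinear convergence of TMA with constant step size: assume min_s ρ_s > 0, fix a policy π ∈ Π, let p* ∈ argmax_{p∈𝒫} J_ρ(π,p), and let (p_t) be the TMA iterates with constant step size β_t = β > 0. Then for every t ≥ 1: J_ρ(π,p*) − J_ρ(π,p_t) ≤ (1/t) · ( M/(1−γ)² + B_{d^{π,p*}_ρ}(p*, p_0) / (β(1−γ)) ). -/

import Mathlib

open scoped BigOperators

noncomputable section

namespace RMDPStmt

variable {S A : ℕ}

/-- `p` is a transition kernel: each `p s a` lies in the probability simplex `Δ^S`. -/
def IsKernel (p : Fin S → Fin A → Fin S → ℝ) : Prop :=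
  ∀ s a, p s a ∈ stdSimplex ℝ (Fin S)

/-- `π` is a stationary randomized policy: each `π s` lies in the simplex `Δ^A`. -/
def IsPolicy (π : Fin S → Fin A → ℝ) : Prop :=
  ∀ s, π s ∈ stdSimplex ℝ (Fin A)

/-- The state-to-state matrix `P^π`. -/
def Pmat (π : Fin S → Fin A → ℝ) (p : Fin S → Fin A → Fin S → ℝ) :
    Matrix (Fin S) (Fin S) ℝ :=
  Matrix.of fun s s' => ∑ a, π s a * p s a s'

/-- The expected one-step cost vector `c^π`. -/
def cvec (c : Fin S → Fin A → Fin S → ℝ) (π : Fin S → Fin A → ℝ)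
    (p : Fin S → Fin A → Fin S → ℝ) : Fin S → ℝ :=
  fun s => ∑ a, π s a * ∑ s', p s a s' * c s a s'

/-- Value function `v^{π,p}` as a discounted series. -/
def value (γ : ℝ) (c : Fin S → Fin A → Fin S → ℝ) (π : Fin S → Fin A → ℝ)
    (p : Fin S → Fin A → Fin S → ℝ) : Fin S → ℝ :=
  fun s => ∑' t : ℕ, γ ^ t * ((Pmat π p ^ t).mulVec (cvec c π p)) s

/-- The return `J_ρ(π,p)`. -/
def J (γ : ℝ) (c : Fin S → Fin A → Fin S → ℝ) (ρ : Fin S → ℝ)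
    (π : Fin S → Fin A → ℝ) (p : Fin S → Fin A → Fin S → ℝ) : ℝ :=
  ∑ s, ρ s * value γ c π p s

/-- The action-value function `q^{π,p}`. -/
def qval (γ : ℝ) (c : Fin S → Fin A → Fin S → ℝ) (π : Fin S → Fin A → ℝ)
    (p : Fin S → Fin A → Fin S → ℝ) : Fin S → Fin A → ℝ :=
  fun s a => ∑ s', p s a s' * (c s a s' + γ * value γ c π p s')

/-- The discounted state occupancy measure `d^{π,p}_ρ`. -/
def occ (γ : ℝ) (ρ : Fin S → ℝ) (π : Fin S → Fin A → ℝ)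
    (p : Fin S → Fin A → Fin S → ℝ) : Fin S → ℝ :=
  fun s' => (1 - γ) * ∑' t : ℕ, γ ^ t * ∑ s, ρ s * (Pmat π p ^ t) s s'

/-- Bregman divergence generated by `h`. -/
def breg {E : Type*} [NormedAddCommGroup E] [NormedSpace ℝ E]
    (h : E → ℝ) (x y : E) : ℝ :=
  h x - h y - fderiv ℝ h y (x - y)

/-- Weighted Bregman divergence `B_μ`. -/
def bregW {E : Type*} [NormedAddCommGroup E] [NormedSpace ℝ E]
    (μ : Fin S → ℝ) (h : E → ℝ) (x y : Fin S → E) : ℝ :=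
  ∑ s, μ s * breg h (x s) (y s)

/-- Inner product of two action-indexed vectors. -/
def dotA (u v : Fin A → ℝ) : ℝ := ∑ a, u a * v a

/-- Inner product of two action-by-state arrays. -/
def dotAS (u v : Fin A → Fin S → ℝ) : ℝ := ∑ a, ∑ s', u a s' * v a s'

/-- The robust objective `Φ(π) = sup_{p ∈ Amb} J_ρ(π,p)`. -/
def Phi (γ : ℝ) (c : Fin S → Fin A → Fin S → ℝ) (ρ : Fin S → ℝ)
    (Amb : Set (Fin S → Fin A → Fin S → ℝ)) (π : Fin S → Fin A → ℝ) : ℝ :=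
  sSup ((fun p => J γ c ρ π p) '' Amb)

/-- The distribution mismatch coefficient
`M = sup_{π ∈ Π, p ∈ Amb} max_s d^{π,p}_ρ(s)/ρ_s`. -/
def mismatch (γ : ℝ) (ρ : Fin S → ℝ)
    (Amb : Set (Fin S → Fin A → Fin S → ℝ)) : ℝ :=
  sSup {x : ℝ | ∃ (π : Fin S → Fin A → ℝ) (p : Fin S → Fin A → Fin S → ℝ),
    IsPolicy π ∧ p ∈ Amb ∧ ∃ s, x = occ γ ρ π p s / ρ s}


/-- The array `ĝ^{π,p}_s ∈ ℝ^{A×S}` with `(ĝ^{π,p}_s)_{as'} = π_{sa}(c_{sas'} + γ v^{π,p}_{s'})`. -/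
def ghat {S A : ℕ} (γ : ℝ) (c : Fin S → Fin A → Fin S → ℝ)
    (π : Fin S → Fin A → ℝ) (p : Fin S → Fin A → Fin S → ℝ) (s : Fin S) :
    Fin A → Fin S → ℝ :=
  fun a s' => π s a * (c s a s' + γ * value γ c π p s')

section Resolvent

open Matrix

variable {n : Type*} [Fintype n] [DecidableEq n]

/-- The discounted resolvent `∑ₜ γᵗ Pᵗ`, defined entrywise. -/
def resolvent (γ : ℝ) (P : Matrix n n ℝ) : Matrix n n ℝ :=
  Matrix.of fun s s' => ∑' t : ℕ, γ ^ t * (P ^ t) s s'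

variable {γ : ℝ} {P : Matrix n n ℝ}

lemma hasSum_resolvent (hγ : γ ∈ Set.Ioo (0 : ℝ) 1) (hP : P ∈ rowStochastic ℝ n) (s s' : n) :
    HasSum (fun t : ℕ => γ ^ t * (P ^ t) s s') (resolvent γ P s s') := by
  refine Summable.hasSum (Summable.of_nonneg_of_le (fun t => ?_) (fun t => ?_)
    (summable_geometric_of_lt_one hγ.1.le hγ.2))
  · exact mul_nonneg (pow_nonneg hγ.1.le t) (nonneg_of_mem_rowStochastic (pow_mem hP t))
  · exact mul_le_of_le_one_right (pow_nonneg hγ.1.le t)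
      (le_one_of_mem_rowStochastic (pow_mem hP t))

lemma resolvent_nonneg (hγ : γ ∈ Set.Ioo (0 : ℝ) 1) (hP : P ∈ rowStochastic ℝ n) (s s' : n) :
    0 ≤ resolvent γ P s s' :=
  tsum_nonneg fun t =>
    mul_nonneg (pow_nonneg hγ.1.le t) (nonneg_of_mem_rowStochastic (pow_mem hP t))

lemma resolvent_eq_one_add_mul (hγ : γ ∈ Set.Ioo (0 : ℝ) 1) (hP : P ∈ rowStochastic ℝ n) :
    resolvent γ P = 1 + γ • (P * resolvent γ P) := by
  ext s s'
  have h₁ := (hasSum_nat_add_iff' 1).2 (hasSum_resolvent hγ hP s s')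
  have h₂ : HasSum (fun t : ℕ => γ ^ (t + 1) * (P ^ (t + 1)) s s')
      ((γ • (P * resolvent γ P)) s s') := by
    have := (hasSum_sum (s := Finset.univ) fun k _ =>
      (hasSum_resolvent hγ hP k s').mul_left (P s k)).mul_left γ
    refine (congrArg (HasSum · _) (funext fun t => ?_)).mpr this
    rw [pow_succ' P, Matrix.mul_apply, Finset.mul_sum, Finset.mul_sum]
    exact Finset.sum_congr rfl fun k _ => by ring
  have := h₁.unique h₂
  simp only [Finset.range_one, Finset.sum_singleton, pow_zero, one_mul] at this
  rw [Matrix.add_apply]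
  linarith

lemma resolvent_eq_one_add_mul' (hγ : γ ∈ Set.Ioo (0 : ℝ) 1) (hP : P ∈ rowStochastic ℝ n) :
    resolvent γ P = 1 + γ • (resolvent γ P * P) := by
  ext s s'
  have h₁ := (hasSum_nat_add_iff' 1).2 (hasSum_resolvent hγ hP s s')
  have h₂ : HasSum (fun t : ℕ => γ ^ (t + 1) * (P ^ (t + 1)) s s')
      ((γ • (resolvent γ P * P)) s s') := by
    have := (hasSum_sum (s := Finset.univ) fun k _ =>
      (hasSum_resolvent hγ hP s k).mul_right (P k s')).mul_left γ
    refine (congrArg (HasSum · _) (funext fun t => ?_)).mpr this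
    rw [pow_succ P, Matrix.mul_apply, Finset.mul_sum, Finset.mul_sum]
    exact Finset.sum_congr rfl fun k _ => by ring
  have := h₁.unique h₂
  simp only [Finset.range_one, Finset.sum_singleton, pow_zero, one_mul] at this
  rw [Matrix.add_apply]
  linarith

lemma one_le_resolvent_diag (hγ : γ ∈ Set.Ioo (0 : ℝ) 1) (hP : P ∈ rowStochastic ℝ n) (s : n) :
    1 ≤ resolvent γ P s s := by
  have := (hasSum_resolvent hγ hP s s).summable.le_tsum 0 fun t _ =>
    mul_nonneg (pow_nonneg hγ.1.le t) (nonneg_of_mem_rowStochastic (pow_mem hP t))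
  simpa [resolvent] using this

lemma sum_resolvent (hγ : γ ∈ Set.Ioo (0 : ℝ) 1) (hP : P ∈ rowStochastic ℝ n) (s : n) :
    ∑ s', resolvent γ P s s' = 1 / (1 - γ) := by
  have h := congrArg (fun R => (R *ᵥ 1) s) (resolvent_eq_one_add_mul' hγ hP)
  simp only [add_mulVec, smul_mulVec, ← mulVec_mulVec, one_vecMul_of_mem_rowStochastic hP,
    one_mulVec, Pi.add_apply, Pi.smul_apply, Pi.one_apply, smul_eq_mul] at h
  have h₁ : (resolvent γ P *ᵥ 1) s = ∑ s', resolvent γ P s s' := by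
    simp [mulVec, dotProduct]
  rw [h₁] at h
  rw [eq_div_iff (by linarith [hγ.2])]
  linarith

lemma resolvent_mulVec_nonneg (hγ : γ ∈ Set.Ioo (0 : ℝ) 1) (hP : P ∈ rowStochastic ℝ n)
    {x : n → ℝ} (hx : ∀ s, 0 ≤ x s) (s : n) : 0 ≤ (resolvent γ P *ᵥ x) s :=
  Finset.sum_nonneg fun s' _ => mul_nonneg (resolvent_nonneg hγ hP s s') (hx s')

lemma le_resolvent_mulVec (hγ : γ ∈ Set.Ioo (0 : ℝ) 1) (hP : P ∈ rowStochastic ℝ n)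
    {x : n → ℝ} (hx : ∀ s, 0 ≤ x s) (s : n) : x s ≤ (resolvent γ P *ᵥ x) s :=
  (le_mul_of_one_le_left (hx s) (one_le_resolvent_diag hγ hP s)).trans
    (Finset.single_le_sum (f := fun s' => resolvent γ P s s' * x s')
      (fun s' _ => mul_nonneg (resolvent_nonneg hγ hP s s') (hx s')) (Finset.mem_univ s))

lemma resolvent_mulVec_le (hγ : γ ∈ Set.Ioo (0 : ℝ) 1) (hP : P ∈ rowStochastic ℝ n)
    {x : n → ℝ} (hx : ∀ s, x s ≤ 1) (s : n) : (resolvent γ P *ᵥ x) s ≤ 1 / (1 - γ) := by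
  rw [← sum_resolvent hγ hP s]
  exact Finset.sum_le_sum fun s' _ =>
    mul_le_of_le_one_right (resolvent_nonneg hγ hP s s') (hx s')

end Resolvent

section MDP

open Matrix

variable {γ : ℝ} {c : Fin S → Fin A → Fin S → ℝ} {ρ : Fin S → ℝ} {π : Fin S → Fin A → ℝ}
  {p q : Fin S → Fin A → Fin S → ℝ}

lemma Pmat_mem_rowStochastic (hπ : IsPolicy π) (hp : IsKernel p) :
    Pmat π p ∈ rowStochastic ℝ (Fin S) := by
  refine mem_rowStochastic_iff_sum.2 ⟨fun s s' => ?_, fun s => ?_⟩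
  · rw [Pmat, Matrix.of_apply]
    exact Finset.sum_nonneg fun a _ => mul_nonneg ((hπ s).1 a) ((hp s a).1 s')
  · simp only [Pmat, Matrix.of_apply]
    rw [Finset.sum_comm]
    simp only [← Finset.mul_sum, (hp s _).2, mul_one]
    exact (hπ s).2

lemma value_eq_resolvent_mulVec (hγ : γ ∈ Set.Ioo (0 : ℝ) 1) (hπ : IsPolicy π)
    (hp : IsKernel p) : value γ c π p = resolvent γ (Pmat π p) *ᵥ cvec c π p := by
  ext s
  have := hasSum_sum (s := Finset.univ) fun k _ =>
    (hasSum_resolvent hγ (Pmat_mem_rowStochastic hπ hp) s k).mul_right (cvec c π p k)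
  refine Eq.trans (tsum_congr fun t => ?_) this.tsum_eq
  rw [mulVec, dotProduct, Finset.mul_sum]
  exact Finset.sum_congr rfl fun k _ => by ring

lemma occ_eq_resolvent (hγ : γ ∈ Set.Ioo (0 : ℝ) 1) (hπ : IsPolicy π)
    (hp : IsKernel p) (s' : Fin S) :
    occ γ ρ π p s' = (1 - γ) * ∑ s, ρ s * resolvent γ (Pmat π p) s s' := by
  have := hasSum_sum (s := Finset.univ) fun k _ =>
    (hasSum_resolvent hγ (Pmat_mem_rowStochastic hπ hp) k s').mul_left (ρ k)
  refine congrArg ((1 - γ) * ·) (Eq.trans (tsum_congr fun t => ?_) this.tsum_eq)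
  rw [Finset.mul_sum]
  exact Finset.sum_congr rfl fun k _ => by ring

lemma sum_occ_mul (hγ : γ ∈ Set.Ioo (0 : ℝ) 1) (hπ : IsPolicy π) (hp : IsKernel p)
    (x : Fin S → ℝ) :
    ∑ s, occ γ ρ π p s * x s = (1 - γ) * ∑ s, ρ s * (resolvent γ (Pmat π p) *ᵥ x) s := by
  simp only [occ_eq_resolvent hγ hπ hp, mulVec, dotProduct, Finset.mul_sum, Finset.sum_mul]
  rw [Finset.sum_comm]
  exact Finset.sum_congr rfl fun k _ => Finset.sum_congr rfl fun s _ => by ring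

lemma occ_nonneg (hγ : γ ∈ Set.Ioo (0 : ℝ) 1) (hρ : ρ ∈ stdSimplex ℝ (Fin S))
    (hπ : IsPolicy π) (hp : IsKernel p) (s : Fin S) : 0 ≤ occ γ ρ π p s := by
  rw [occ_eq_resolvent hγ hπ hp]
  exact mul_nonneg (by linarith [hγ.2]) (Finset.sum_nonneg fun k _ =>
    mul_nonneg (hρ.1 k) (resolvent_nonneg hγ (Pmat_mem_rowStochastic hπ hp) k s))

lemma sum_occ (hγ : γ ∈ Set.Ioo (0 : ℝ) 1) (hρ : ρ ∈ stdSimplex ℝ (Fin S))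
    (hπ : IsPolicy π) (hp : IsKernel p) : ∑ s, occ γ ρ π p s = 1 := by
  have h := sum_occ_mul (ρ := ρ) hγ hπ hp 1
  have h₁ (s : Fin S) : (resolvent γ (Pmat π p) *ᵥ 1) s = 1 / (1 - γ) := by
    rw [← sum_resolvent hγ (Pmat_mem_rowStochastic hπ hp) s]
    simp [mulVec, dotProduct]
  simp only [Pi.one_apply, mul_one, h₁, ← Finset.sum_mul, hρ.2, one_mul] at h
  rw [h, mul_one_div_cancel (by linarith [hγ.2])]

lemma occ_le_one (hγ : γ ∈ Set.Ioo (0 : ℝ) 1) (hρ : ρ ∈ stdSimplex ℝ (Fin S))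
    (hπ : IsPolicy π) (hp : IsKernel p) (s : Fin S) : occ γ ρ π p s ≤ 1 := by
  rw [← sum_occ hγ hρ hπ hp]
  exact Finset.single_le_sum (fun k _ => occ_nonneg hγ hρ hπ hp k) (Finset.mem_univ s)

lemma occ_le_mismatch_mul (hγ : γ ∈ Set.Ioo (0 : ℝ) 1) (hρ : ρ ∈ stdSimplex ℝ (Fin S))
    (hρpos : ∀ s, 0 < ρ s) {Amb : Set (Fin S → Fin A → Fin S → ℝ)}
    (hAmb : ∀ q ∈ Amb, IsKernel q) (hπ : IsPolicy π) (hp : p ∈ Amb) (s : Fin S) :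
    occ γ ρ π p s ≤ mismatch γ ρ Amb * ρ s := by
  rw [← div_le_iff₀ (hρpos s)]
  refine le_csSup ⟨∑ k, 1 / ρ k, ?_⟩ ⟨π, p, hπ, hp, s, rfl⟩
  rintro _ ⟨π', q, hπ', hq, k, rfl⟩
  calc occ γ ρ π' q k / ρ k ≤ 1 / ρ k :=
        div_le_div_of_nonneg_right (occ_le_one hγ hρ hπ' (hAmb q hq) k) (hρpos k).le
    _ ≤ _ := Finset.single_le_sum (f := fun k => 1 / ρ k)
        (fun k _ => (one_div_pos.2 (hρpos k)).le) (Finset.mem_univ k)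

lemma cvec_mem_Icc (hc : ∀ s a s', c s a s' ∈ Set.Icc (0 : ℝ) 1) (hπ : IsPolicy π)
    (hp : IsKernel p) (s : Fin S) : cvec c π p s ∈ Set.Icc (0 : ℝ) 1 := by
  have h₀ (a : Fin A) : 0 ≤ ∑ s', p s a s' * c s a s' :=
    Finset.sum_nonneg fun s' _ => mul_nonneg ((hp s a).1 s') (hc s a s').1
  have h₁ (a : Fin A) : ∑ s', p s a s' * c s a s' ≤ 1 := by
    rw [← (hp s a).2]
    exact Finset.sum_le_sum fun s' _ => mul_le_of_le_one_right ((hp s a).1 s') (hc s a s').2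
  refine ⟨Finset.sum_nonneg fun a _ => mul_nonneg ((hπ s).1 a) (h₀ a), ?_⟩
  rw [← (hπ s).2]
  exact Finset.sum_le_sum fun a _ => mul_le_of_le_one_right ((hπ s).1 a) (h₁ a)

lemma J_mem_Icc (hγ : γ ∈ Set.Ioo (0 : ℝ) 1) (hc : ∀ s a s', c s a s' ∈ Set.Icc (0 : ℝ) 1)
    (hρ : ρ ∈ stdSimplex ℝ (Fin S)) (hπ : IsPolicy π) (hp : IsKernel p) :
    J γ c ρ π p ∈ Set.Icc 0 (1 / (1 - γ)) := by
  have hP := Pmat_mem_rowStochastic hπ hp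
  rw [J, value_eq_resolvent_mulVec hγ hπ hp]
  constructor
  · exact Finset.sum_nonneg fun s _ => mul_nonneg (hρ.1 s)
      (resolvent_mulVec_nonneg hγ hP (fun k => (cvec_mem_Icc hc hπ hp k).1) s)
  · calc ∑ s, ρ s * (resolvent γ (Pmat π p) *ᵥ cvec c π p) s
        ≤ ∑ s, ρ s * (1 / (1 - γ)) := Finset.sum_le_sum fun s _ => mul_le_mul_of_nonneg_left
          (resolvent_mulVec_le hγ hP (fun k => (cvec_mem_Icc hc hπ hp k).2) s) (hρ.1 s)
      _ = 1 / (1 - γ) := by rw [← Finset.sum_mul, hρ.2, one_mul]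

lemma dotAS_ghat (s : Fin S) :
    dotAS (ghat γ c π q s) (p s) =
      cvec c π p s + γ * (Pmat π p *ᵥ value γ c π q) s := by
  simp only [dotAS, ghat, cvec, Pmat, mulVec, dotProduct, Matrix.of_apply, Finset.mul_sum,
    Finset.sum_mul]
  rw [Finset.sum_comm (γ := Fin S), ← Finset.sum_add_distrib]
  refine Finset.sum_congr rfl fun a _ => ?_
  rw [← Finset.sum_add_distrib]
  exact Finset.sum_congr rfl fun s' _ => by ring

/-- Bellman equation, in terms of `ghat`. -/
lemma dotAS_ghat_self (hγ : γ ∈ Set.Ioo (0 : ℝ) 1) (hπ : IsPolicy π) (hq : IsKernel q)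
    (s : Fin S) : dotAS (ghat γ c π q s) (q s) = value γ c π q s := by
  have h := congrArg (fun R => (R *ᵥ cvec c π q) s)
    (resolvent_eq_one_add_mul hγ (Pmat_mem_rowStochastic hπ hq))
  simp only [add_mulVec, smul_mulVec, ← mulVec_mulVec, ← value_eq_resolvent_mulVec hγ hπ hq,
    one_mulVec, Pi.add_apply, Pi.smul_apply, smul_eq_mul] at h
  rw [dotAS_ghat, h]

/-- Performance difference lemma for two kernels, at the level of value functions. -/
lemma value_sub_value (hγ : γ ∈ Set.Ioo (0 : ℝ) 1) (hπ : IsPolicy π) (hp : IsKernel p)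
    (hq : IsKernel q) :
    value γ c π p - value γ c π q = resolvent γ (Pmat π p) *ᵥ
      fun s => dotAS (ghat γ c π q s) (p s) - dotAS (ghat γ c π q s) (q s) := by
  have h := congrArg (fun R => R *ᵥ value γ c π q)
    (resolvent_eq_one_add_mul' hγ (Pmat_mem_rowStochastic hπ hp))
  simp only [add_mulVec, smul_mulVec, ← mulVec_mulVec, one_mulVec] at h
  have hg : (fun s => dotAS (ghat γ c π q s) (p s) - dotAS (ghat γ c π q s) (q s)) =
      cvec c π p + γ • (Pmat π p *ᵥ value γ c π q) - value γ c π q := by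
    ext s
    simp [dotAS_ghat_self hγ hπ hq, dotAS_ghat (p := p)]
  rw [hg, mulVec_sub, mulVec_add, mulVec_smul, h, ← value_eq_resolvent_mulVec hγ hπ hp]
  abel

/-- Performance difference lemma for two kernels. -/
lemma sum_occ_mul_dotAS_sub (hγ : γ ∈ Set.Ioo (0 : ℝ) 1) (hπ : IsPolicy π) (hp : IsKernel p)
    (hq : IsKernel q) :
    ∑ s, occ γ ρ π p s * (dotAS (ghat γ c π q s) (p s) - dotAS (ghat γ c π q s) (q s)) =
      (1 - γ) * (J γ c ρ π p - J γ c ρ π q) := by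
  rw [sum_occ_mul hγ hπ hp, ← value_sub_value hγ hπ hp hq]
  simp only [J, Pi.sub_apply, mul_sub, Finset.sum_sub_distrib]

end MDP

section Bregman

variable {E : Type*} [NormedAddCommGroup E] [NormedSpace ℝ E] {h : E → ℝ}

lemma breg_nonneg (hconv : ConvexOn ℝ Set.univ h) {y : E} (hd : DifferentiableAt ℝ h y)
    (x : E) : 0 ≤ breg h x y := by
  have hline : ConvexOn ℝ Set.univ (h ∘ AffineMap.lineMap (k := ℝ) y x) :=
    hconv.comp_affineMap (AffineMap.lineMap y x)
  have hderiv : HasDerivAt (h ∘ AffineMap.lineMap (k := ℝ) y x) (fderiv ℝ h y (x - y)) 0 := by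
    refine HasFDerivAt.comp_hasDerivAt (0 : ℝ) ?_ AffineMap.hasDerivAt_lineMap
    simpa using hd.hasFDerivAt
  have := hline.le_slope_of_hasDerivAt (Set.mem_univ 0) (Set.mem_univ 1) one_pos hderiv
  simp only [slope_def_field, Function.comp_apply, AffineMap.lineMap_apply_one,
    AffineMap.lineMap_apply_zero, sub_zero, div_one] at this
  rw [breg]
  linarith

/-- Three-point inequality for a Bregman proximal step. -/
lemma breg_three_point (hd : Differentiable ℝ h) (L : E →L[ℝ] ℝ) {C : Set E}
    (hC : Convex ℝ C) {x y z : E} (hx : x ∈ C) (hz : z ∈ C)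
    (hmax : ∀ w ∈ C, L w - breg h w y ≤ L z - breg h z y) :
    L x - breg h x y + breg h x z ≤ L z - breg h z y := by
  have hderiv : HasFDerivAt (fun w => L w - breg h w y)
      (L - (fderiv ℝ h z - fderiv ℝ h y)) z := by
    refine L.hasFDerivAt.sub (((hd z).hasFDerivAt.sub_const (h y)).sub ?_)
    exact (fderiv ℝ h y).hasFDerivAt.comp z ((hasFDerivAt_id z).sub_const y)
  have hlocal : IsLocalMaxOn (fun w => L w - breg h w y) C z :=
    IsMaxOn.localize hmax
  have := hlocal.hasFDerivWithinAt_nonpos hderiv.hasFDerivWithinAt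
    (sub_mem_posTangentConeAt_of_segment_subset (hC.segment_subset hz hx))
  simp only [sub_apply, map_sub] at this
  simp only [breg, map_sub]
  linarith

end Bregman

/-- `dotAS u` as a continuous linear functional. -/
def dotASL (u : Fin A → Fin S → ℝ) : (Fin A → Fin S → ℝ) →L[ℝ] ℝ :=
  LinearMap.toContinuousLinearMap
    { toFun := dotAS u
      map_add' := fun x y => by simp [dotAS, mul_add, Finset.sum_add_distrib]
      map_smul' := fun r x => by simp [dotAS, Finset.mul_sum, mul_left_comm] }

lemma dotAS_three_point {h : (Fin A → Fin S → ℝ) → ℝ} (hd : Differentiable ℝ h)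
    {β : ℝ} {g : Fin A → Fin S → ℝ} {C : Set (Fin A → Fin S → ℝ)} (hC : Convex ℝ C)
    {x y z : Fin A → Fin S → ℝ} (hx : x ∈ C) (hz : z ∈ C)
    (hmax : ∀ w ∈ C, β * dotAS g w - breg h w y ≤ β * dotAS g z - breg h z y) :
    β * dotAS g x - breg h x y + breg h x z ≤ β * dotAS g z - breg h z y :=
  breg_three_point hd (β • dotASL g) hC hx hz hmax

/-- Sublinear convergence of TMA with constant step size. -/
theorem tma_sublinear_convergence
    {S A : ℕ} (hS : 0 < S) (hA : 0 < A)
    (γ : ℝ) (hγ : γ ∈ Set.Ioo (0 : ℝ) 1)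
    (c : Fin S → Fin A → Fin S → ℝ)
    (hc : ∀ s a s', c s a s' ∈ Set.Icc (0 : ℝ) 1)
    (ρ : Fin S → ℝ) (hρ : ρ ∈ stdSimplex ℝ (Fin S)) (hρpos : ∀ s, 0 < ρ s)
    -- s-rectangular ambiguity set
    (Ps : Fin S → Set (Fin A → Fin S → ℝ))
    (hPsne : ∀ s, (Ps s).Nonempty) (hPscpt : ∀ s, IsCompact (Ps s))
    (hPsconv : ∀ s, Convex ℝ (Ps s))
    (hPssub : ∀ s, ∀ x ∈ Ps s, ∀ a, x a ∈ stdSimplex ℝ (Fin S))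
    (Amb : Set (Fin S → Fin A → Fin S → ℝ))
    (hAmb : Amb = {p | ∀ s, p s ∈ Ps s})
    -- fixed policy
    (π : Fin S → Fin A → ℝ) (hπ : IsPolicy π)
    -- Bregman generating function
    (h : (Fin A → Fin S → ℝ) → ℝ) (hh : ContDiff ℝ 1 h)
    (hhconv : StrictConvexOn ℝ Set.univ h)
    -- worst-case transition kernel p⋆ ∈ argmax_{p ∈ Amb} J_ρ(π,p)
    (ps : Fin S → Fin A → Fin S → ℝ) (hps : ps ∈ Amb)
    (hpsmax : ∀ q ∈ Amb, J γ c ρ π q ≤ J γ c ρ π ps)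
    -- TMA iterates with constant step size β > 0
    (β : ℝ) (hβ : 0 < β)
    (p : ℕ → Fin S → Fin A → Fin S → ℝ) (hp : ∀ t s, p t s ∈ Ps s)
    (hupd : ∀ t s, ∀ x ∈ Ps s,
      β * dotAS (ghat γ c π (p t) s) x - breg h x (p t s) ≤
        β * dotAS (ghat γ c π (p t) s) (p (t + 1) s) -
          breg h (p (t + 1) s) (p t s)) :
    ∀ t : ℕ, 1 ≤ t →
      J γ c ρ π ps - J γ c ρ π (p t) ≤
        (1 / (t : ℝ)) * (mismatch γ ρ Amb / (1 - γ) ^ 2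
          + bregW (occ γ ρ π ps) h ps (p 0) / (β * (1 - γ))) := by
  have hker (q) (hq : q ∈ Amb) : IsKernel q := by
    subst hAmb
    exact fun s => hPssub s (q s) (hq s)
  have hps' (s) : ps s ∈ Ps s := by
    subst hAmb
    exact hps s
  have hpk (t) : IsKernel (p t) := fun s => hPssub s (p t s) (hp t s)
  have hpsk := hker ps hps
  have hd : Differentiable ℝ h := hh.differentiable one_ne_zero
  have hγ' : 0 < 1 - γ := by linarith [hγ.2]
  have hB (x y) : 0 ≤ breg h x y := breg_nonneg hhconv.convexOn (hd y) x
  set f : ℕ → Fin S → ℝ := fun t s => dotAS (ghat γ c π (p t) s) (p (t + 1) s)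
    - dotAS (ghat γ c π (p t) s) (p t s) with hf
  set d := occ γ ρ π ps with hd_def
  set M := mismatch γ ρ Amb
  have hd0 (s) : 0 ≤ d s := occ_nonneg hγ hρ hπ hpsk s
  have hdM (s) : d s ≤ M * ρ s := occ_le_mismatch_mul hγ hρ hρpos hker hπ hps s
  have hM0 : 0 ≤ M :=
    nonneg_of_mul_nonneg_left ((hd0 ⟨0, hS⟩).trans (hdM ⟨0, hS⟩)) (hρpos _)
  have hf0 (t s) : 0 ≤ f t s := by
    have h₁ := dotAS_three_point hd (hPsconv s) (hp t s) (hp (t + 1) s) (hupd t s)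
    have h₂ : breg h (p t s) (p t s) = 0 := by simp [breg]
    have h₃ := hB (p t s) (p (t + 1) s)
    have h₄ := hB (p (t + 1) s) (p t s)
    exact nonneg_of_mul_nonneg_right (a := β) (by simp only [hf]; linarith) hβ
  have hfJ (t) : ∑ s, ρ s * f t s ≤ J γ c ρ π (p (t + 1)) - J γ c ρ π (p t) := by
    rw [J, J, ← Finset.sum_sub_distrib]
    refine Finset.sum_le_sum fun s _ => ?_
    rw [← mul_sub]
    refine mul_le_mul_of_nonneg_left ?_ (hρpos s).le
    rw [← Pi.sub_apply, value_sub_value hγ hπ (hpk (t + 1)) (hpk t)]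
    exact le_resolvent_mulVec hγ (Pmat_mem_rowStochastic hπ (hpk (t + 1))) (hf0 t) s
  have hmono : Monotone fun t => J γ c ρ π (p t) := by
    refine monotone_nat_of_le_succ fun t => ?_
    have := Finset.sum_nonneg fun s (_ : s ∈ Finset.univ) => mul_nonneg (hρpos s).le (hf0 t s)
    linarith [hfJ t]
  have hstep (t) : β * (1 - γ) * (J γ c ρ π ps - J γ c ρ π (p t)) ≤
      β * M * (J γ c ρ π (p (t + 1)) - J γ c ρ π (p t))
        + (bregW d h ps (p t) - bregW d h ps (p (t + 1))) := by
    have h₁ : ∑ s, d s * f t s ≤ M * (J γ c ρ π (p (t + 1)) - J γ c ρ π (p t)) :=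
      calc ∑ s, d s * f t s ≤ ∑ s, M * (ρ s * f t s) := Finset.sum_le_sum fun s _ => by
            rw [← mul_assoc]
            exact mul_le_mul_of_nonneg_right (hdM s) (hf0 t s)
        _ = M * ∑ s, ρ s * f t s := (Finset.mul_sum ..).symm
        _ ≤ _ := mul_le_mul_of_nonneg_left (hfJ t) hM0
    have h₂ : β * (∑ s, d s * (dotAS (ghat γ c π (p t) s) (ps s)
          - dotAS (ghat γ c π (p t) s) (p t s))) ≤
        β * (∑ s, d s * f t s) + (bregW d h ps (p t) - bregW d h ps (p (t + 1))) := by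
      simp only [bregW, Finset.mul_sum]
      rw [← Finset.sum_sub_distrib, ← Finset.sum_add_distrib]
      refine Finset.sum_le_sum fun s _ => ?_
      have h₃ := dotAS_three_point hd (hPsconv s) (hps' s) (hp (t + 1) s) (hupd t s)
      have h₄ := hB (p (t + 1) s) (p t s)
      have h₅ := mul_le_mul_of_nonneg_left (h₃.trans (sub_le_self _ h₄)) (hd0 s)
      simp only [hf]
      linarith
    rw [hd_def, sum_occ_mul_dotAS_sub hγ hπ hpsk (hpk t), ← hd_def] at h₂
    have h₆ := mul_le_mul_of_nonneg_left h₁ hβ.le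
    linarith
  have htel (t : ℕ) : ∑ k ∈ Finset.range t, β * (1 - γ) * (J γ c ρ π ps - J γ c ρ π (p k)) ≤
      β * M * (J γ c ρ π (p t) - J γ c ρ π (p 0))
        + (bregW d h ps (p 0) - bregW d h ps (p t)) := by
    induction t with
    | zero => simp
    | succ t ih =>
      rw [Finset.sum_range_succ]
      linarith [hstep t]
  intro t ht
  have ht' : (0 : ℝ) < t := by exact_mod_cast ht
  have hlow : t * (β * (1 - γ) * (J γ c ρ π ps - J γ c ρ π (p t))) ≤
      ∑ k ∈ Finset.range t, β * (1 - γ) * (J γ c ρ π ps - J γ c ρ π (p k)) := by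
    have := Finset.card_nsmul_le_sum (Finset.range t)
      (fun k => β * (1 - γ) * (J γ c ρ π ps - J γ c ρ π (p k)))
      (β * (1 - γ) * (J γ c ρ π ps - J γ c ρ π (p t))) fun k hk =>
        mul_le_mul_of_nonneg_left (sub_le_sub_left (hmono (Finset.mem_range.1 hk).le) _)
          (mul_pos hβ hγ').le
    simpa using this
  have hBt : 0 ≤ bregW d h ps (p t) :=
    Finset.sum_nonneg fun s _ => mul_nonneg (hd0 s) (hB _ _)
  have hJ : β * M * (J γ c ρ π (p t) - J γ c ρ π (p 0)) ≤ β * M * (1 / (1 - γ)) :=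
    mul_le_mul_of_nonneg_left (by
      linarith [(J_mem_Icc hγ hc hρ hπ (hpk t)).2, (J_mem_Icc hγ hc hρ hπ (hpk 0)).1])
      (mul_nonneg hβ.le hM0)
  have hfin : t * (β * (1 - γ) * (J γ c ρ π ps - J γ c ρ π (p t))) ≤
      β * M * (1 / (1 - γ)) + bregW d h ps (p 0) := by
    linarith [htel t]
  have heq : (1 / (t : ℝ)) * (M / (1 - γ) ^ 2 + bregW d h ps (p 0) / (β * (1 - γ))) =
      (β * M * (1 / (1 - γ)) + bregW d h ps (p 0)) / (t * (β * (1 - γ))) := by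
    field_simp
  rw [heq, le_div_iff₀ (mul_pos ht' (mul_pos hβ hγ'))]
  linarith

end RMDPStmt
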